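/- There exists N such that for all n ≥ N the following holds: if F is a family of at least 2^{0.44n} subsets of [n] = {1,…,n}, then there exist sets A, B, C, D, E, F' ∈ F with A ≠ B, C ≠ D, E ≠ F', such that the three symmetric differences A △ B, C △ D and E △ F' are pairwise disjoint. -/

import Mathlib

open scoped symmDiff

section Walsh

open Finset

variable {ι : Type*} [Fintype ι] [DecidableEq ι]

/-- The Walsh character `(-1) ^ |z ∩ x|`. -/
noncomputable def walsh (z x : Finset ι) : ℝ :=
  ∏ i, if i ∈ z ∧ i ∈ x then -1 else 1

/-- The Walsh transform of a function on the cube. -/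
noncomputable def walshTransform (f : Finset ι → ℝ) (x : Finset ι) : ℝ :=
  ∑ z, f z * walsh z x

lemma walsh_comm (z x : Finset ι) : walsh z x = walsh x z := by
  simp only [walsh, and_comm]

lemma walsh_symmDiff_left (z w x : Finset ι) : walsh (z ∆ w) x = walsh z x * walsh w x := by
  simp only [walsh, ← prod_mul_distrib]
  refine prod_congr rfl fun i _ => ?_
  by_cases hz : i ∈ z <;> by_cases hw : i ∈ w <;> by_cases hx : i ∈ x <;>
    simp [mem_symmDiff, hz, hw, hx]

lemma walsh_symmDiff_right (z x y : Finset ι) : walsh z (x ∆ y) = walsh z x * walsh z y := by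
  rw [walsh_comm, walsh_symmDiff_left, walsh_comm x, walsh_comm y]

lemma walsh_empty_left (x : Finset ι) : walsh ∅ x = 1 := by simp [walsh]

lemma walsh_empty_right (x : Finset ι) : walsh x ∅ = 1 := by simp [walsh]

lemma walsh_singleton_left (i : ι) (x : Finset ι) :
    walsh {i} x = if i ∈ x then -1 else 1 := by
  rw [walsh, prod_eq_single i] <;> simp +contextual

lemma sum_walsh_singleton (x : Finset ι) :
    ∑ i, walsh {i} x = (Fintype.card ι : ℝ) - 2 * #x := by
  have h : ∀ i, walsh {i} x = 1 - 2 * (if i ∈ x then 1 else 0) := fun i => by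
    rw [walsh_singleton_left]; split_ifs <;> norm_num
  simp [h, mul_comm]

lemma walshTransform_sum_neighbors (f : Finset ι → ℝ) (x : Finset ι) :
    walshTransform (fun z => ∑ i, f (z ∆ {i})) x
      = ((Fintype.card ι : ℝ) - 2 * #x) * walshTransform f x := by
  rw [← sum_walsh_singleton, sum_mul]
  simp only [walshTransform, sum_mul]
  rw [sum_comm]
  refine sum_congr rfl fun i _ => ?_
  rw [← Equiv.sum_comp (symmDiff_left_involutive ({i} : Finset ι)).toPerm, mul_sum]
  refine sum_congr rfl fun z _ => ?_
  simp only [Function.Involutive.coe_toPerm, symmDiff_symmDiff_cancel_right,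
    walsh_symmDiff_left]
  ring

lemma card_sq_mul_le_sum_walshTransform_mul (C : Finset (Finset ι)) {g h : Finset ι → ℝ}
    (hg : 0 ≤ g) (hh : 0 ≤ h) :
    (∑ z, g z * h z) * (#C : ℝ) ^ 2
      ≤ ∑ x ∈ C, ∑ y ∈ C, walshTransform g (x ∆ y) * walshTransform h (x ∆ y) := by
  have key : ∑ x ∈ C, ∑ y ∈ C, walshTransform g (x ∆ y) * walshTransform h (x ∆ y)
      = ∑ z, ∑ w, g z * h w * (∑ x ∈ C, walsh (z ∆ w) x) ^ 2 := by
    trans ∑ p ∈ C ×ˢ C, ∑ q : Finset ι × Finset ι,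
      g q.1 * h q.2 * (walsh (q.1 ∆ q.2) p.1 * walsh (q.1 ∆ q.2) p.2)
    · simp only [sum_product, Fintype.sum_prod_type, walshTransform, sum_mul_sum]
      refine sum_congr rfl fun x _ => sum_congr rfl fun y _ => sum_congr rfl fun z _ =>
        sum_congr rfl fun w _ => ?_
      rw [← walsh_symmDiff_right, walsh_symmDiff_left]
      ring
    · rw [sum_comm, Fintype.sum_prod_type]
      simp only [sq, sum_mul_sum, sum_product]
      simp only [mul_sum]
  rw [key, sum_mul]
  refine sum_le_sum fun z _ => ?_
  refine le_trans (le_of_eq ?_) (single_le_sum (s := univ)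
    (f := fun w => g z * h w * (∑ x ∈ C, walsh (z ∆ w) x) ^ 2) (fun w _ => ?_) (mem_univ z))
  · simp [walsh_empty_left]
  · have := hg z
    have := hh w
    simp only [Pi.zero_apply] at *
    positivity

/-- The first linear programming bound in spectral form: a code with minimum distance `d` is not
much larger than any set `B` supporting an approximate eigenfunction of the cube with eigenvalue
`l > card ι - 2 d`. -/
theorem card_mul_le_of_approx_eigenfunction (C B : Finset (Finset ι)) {f : Finset ι → ℝ}
    {l l' : ℝ} (hf : 0 ≤ f) (hfB : ∀ z ∉ B, f z = 0) (hf0 : f ≠ 0)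
    (hl : ∀ z, l * f z ≤ ∑ i, f (z ∆ {i})) (hll : l' ≤ l) (hl' : l' ≤ Fintype.card ι)
    (hC : ∀ x ∈ C, ∀ y ∈ C, x ≠ y → (Fintype.card ι : ℝ) - 2 * #(x ∆ y) ≤ l') :
    (l - l') * #C ≤ (Fintype.card ι - l') * #B := by
  set n : ℝ := (Fintype.card ι : ℝ)
  have h1 : 0 ≤ ∑ x ∈ C, ∑ y ∈ C,
      (n - 2 * #(x ∆ y) - l) * walshTransform f (x ∆ y) ^ 2 := by
    have h := card_sq_mul_le_sum_walshTransform_mul C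
      (g := fun z => ∑ i, f (z ∆ {i}) - l * f z) (h := f) (fun z => sub_nonneg.2 (hl z)) hf
    have h' : ∀ x, walshTransform (fun z => ∑ i, f (z ∆ {i}) - l * f z) x
        = (n - 2 * #x - l) * walshTransform f x := fun x => by
      rw [sub_mul, ← walshTransform_sum_neighbors]
      simp only [walshTransform, sub_mul, sum_sub_distrib, mul_sum, mul_assoc]
    simp only [h', mul_assoc, ← sq] at h
    refine le_trans ?_ h
    exact mul_nonneg (sum_nonneg fun z _ => mul_nonneg (sub_nonneg.2 (hl z)) (hf z)) (sq_nonneg _)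
  have h2 := card_sq_mul_le_sum_walshTransform_mul C hf hf
  have h3 : ∑ x ∈ C, ∑ y ∈ C, (n - 2 * #(x ∆ y) - l') * walshTransform f (x ∆ y) ^ 2
      ≤ ∑ x ∈ C, (n - l') * (∑ z, f z) ^ 2 := by
    refine sum_le_sum fun x hx => ?_
    rw [← add_sum_erase _ _ hx]
    have h4 : ∑ y ∈ C.erase x, (n - 2 * #(x ∆ y) - l') * walshTransform f (x ∆ y) ^ 2 ≤ 0 :=
      sum_nonpos fun y hy => mul_nonpos_of_nonpos_of_nonneg
        (sub_nonpos.2 (hC x hx y (mem_of_mem_erase hy) (ne_of_mem_erase hy).symm)) (sq_nonneg _)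
    have h5 : walshTransform f (x ∆ x) = ∑ z, f z := by
      simp [walshTransform, walsh_empty_right]
    rw [h5]
    simp only [symmDiff_self, bot_eq_empty, card_empty, Nat.cast_zero]
    linarith
  have h6 : (∑ z, f z) ^ 2 ≤ #B * ∑ z, f z * f z := by
    have e1 : ∑ z, f z = ∑ z ∈ B, f z :=
      (sum_subset (subset_univ B) fun z _ hz => hfB z hz).symm
    have e2 : ∑ z ∈ B, f z ^ 2 ≤ ∑ z, f z * f z := by
      simp only [← sq]
      exact sum_le_sum_of_subset_of_nonneg (subset_univ B) fun _ _ _ => sq_nonneg _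
    rw [e1]
    exact (sq_sum_le_card_mul_sum_sq).trans (by gcongr)
  have hpos : 0 < ∑ z, f z * f z := by
    obtain ⟨z, hz⟩ := Function.ne_iff.1 hf0
    exact sum_pos' (fun z _ => mul_self_nonneg _) ⟨z, mem_univ z, mul_self_pos.2 hz⟩
  have h7 : ∑ x ∈ C, ∑ y ∈ C, (n - 2 * #(x ∆ y) - l') * walshTransform f (x ∆ y) ^ 2
      = ∑ x ∈ C, ∑ y ∈ C, (n - 2 * #(x ∆ y) - l) * walshTransform f (x ∆ y) ^ 2
        + (l - l') * ∑ x ∈ C, ∑ y ∈ C, walshTransform f (x ∆ y) * walshTransform f (x ∆ y) := by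
    simp only [mul_sum, ← sum_add_distrib]
    exact sum_congr rfl fun x _ => sum_congr rfl fun y _ => by ring
  rw [sum_const, nsmul_eq_mul, h7] at h3
  rcases C.eq_empty_or_nonempty with rfl | hne
  · simpa using mul_nonneg (sub_nonneg.2 hl') (Nat.cast_nonneg _)
  have hc : (0 : ℝ) < #C := by exact_mod_cast hne.card_pos
  refine le_of_mul_le_mul_right ?_ (mul_pos hc hpos)
  have h8 := mul_le_mul_of_nonneg_left h2 (sub_nonneg.2 hll)
  have h9 := mul_le_mul_of_nonneg_left h6 (mul_nonneg hc.le (sub_nonneg.2 hl'))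
  nlinarith

end Walsh

section ClosePairs

open Finset Filter

/-- The tent function of height and half-width `M` centred at `p`. -/
noncomputable def tent (p M t : ℝ) : ℝ := max 0 (M - |t - p|)

lemma tent_nonneg (p M t : ℝ) : 0 ≤ tent p M t := le_max_left _ _

lemma tent_mul_le {M : ℝ} (hM : 0 < M) (p t : ℝ) :
    (2 - 2 / M) * tent p M t ≤ tent p M (t - 1) + tent p M (t + 1) := by
  have h1 := tent_nonneg p M (t - 1)
  have h2 := tent_nonneg p M (t + 1)
  have h3 : M - |t - 1 - p| ≤ tent p M (t - 1) := le_max_right _ _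
  have h4 : M - |t + 1 - p| ≤ tent p M (t + 1) := le_max_right _ _
  rcases le_total (M - |t - p|) 0 with h | h
  · rw [tent, max_eq_left h]
    linarith
  · rw [tent, max_eq_right h]
    have h5 : (2 - 2 / M) * (M - |t - p|) = 2 * M - 2 * |t - p| - 2 * (1 - |t - p| / M) := by
      field_simp
    have h6 : |t - p| / M ≤ 1 := by
      rw [div_le_one hM]
      linarith
    rcases le_total M 1 with h8 | h8
    · have : 2 ≤ 2 / M := by rw [le_div_iff₀ hM]; linarith
      nlinarith
    · have h9 : |t - p| / M ≤ |t - p| := div_le_self (abs_nonneg _) h8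
      rw [h5]
      rcases abs_cases (t - p) with ⟨ha, _⟩ | ⟨ha, _⟩ <;>
      rcases abs_cases (t - 1 - p) with ⟨hb, _⟩ | ⟨hb, _⟩ <;>
      rcases abs_cases (t + 1 - p) with ⟨hc, _⟩ | ⟨hc, _⟩ <;>
      linarith

variable {ι : Type*} [Fintype ι]

lemma card_filter_card_le_le {θ : ℝ} (hθ : 0 < θ) (hθ1 : θ ≤ 1) (ρ : ℝ) :
    (#{z : Finset ι | (#z : ℝ) ≤ ρ * Fintype.card ι} : ℝ)
      ≤ (θ ^ (-ρ) * (1 + θ)) ^ Fintype.card ι := by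
  set n := Fintype.card ι
  have h : ((1 + θ) ^ n : ℝ) = ∑ z : Finset ι, θ ^ #z := by
    rw [add_comm, ← Fintype.sum_pow_mul_eq_add_pow]
    simp
  have hr : (θ ^ (-ρ)) ^ n = θ ^ (-(ρ * n)) := by
    rw [← Real.rpow_mul_natCast hθ.le, neg_mul]
  rw [mul_pow, h, mul_sum, card_eq_sum_ones, Nat.cast_sum]
  refine le_trans (sum_le_sum fun z hz => ?_)
    (sum_le_sum_of_subset_of_nonneg (subset_univ _) fun _ _ _ => by positivity)
  have hz' : (#z : ℝ) ≤ ρ * n := (mem_filter.1 hz).2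
  rw [hr, ← Real.rpow_natCast θ #z, ← Real.rpow_add hθ, Nat.cast_one]
  exact Real.one_le_rpow_of_pos_of_le_one_of_nonpos hθ hθ1 (by linarith)

variable [DecidableEq ι]

lemma sum_card_symmDiff_singleton (φ : ℕ → ℝ) (z : Finset ι) :
    ∑ i, φ #(z ∆ {i}) = #z * φ (#z - 1) + (Fintype.card ι - #z) * φ (#z + 1) := by
  rw [← sum_add_sum_compl z]
  congr 1
  · rw [← nsmul_eq_mul, ← sum_const]
    refine sum_congr rfl fun i hi => ?_
    have : z ∆ {i} = z.erase i := by
      ext j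
      by_cases hj : j = i <;> simp [mem_symmDiff, hj, hi]
    rw [this, card_erase_of_mem hi]
  · rw [← Nat.cast_sub (card_le_univ z), ← card_compl, ← nsmul_eq_mul, ← sum_const]
    refine sum_congr rfl fun i hi => ?_
    have hi' : i ∉ z := by simpa using hi
    have : z ∆ {i} = insert i z := by
      ext j
      by_cases hj : j = i <;> simp [mem_symmDiff, hj, hi']
    rw [this, card_insert_of_notMem hi']

lemma mul_le_sum_neighbors_tent {c μ p M : ℝ} (hc : 0 < c) (hμ : 0 ≤ μ) (hM : 0 < M)
    (h1 : c * (μ * Fintype.card ι) ≤ p - M)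
    (h2 : μ * Fintype.card ι ≤ (Fintype.card ι - (p + M)) * c) (z : Finset ι) :
    μ * Fintype.card ι * (2 - 2 / M) * (c ^ #z * tent p M #z)
      ≤ ∑ i, c ^ #(z ∆ {i}) * tent p M #(z ∆ {i}) := by
  have hs := sum_card_symmDiff_singleton (fun k => c ^ k * tent p M k) z
  have hle : (#z : ℝ) ≤ Fintype.card ι := by exact_mod_cast card_le_univ z
  rw [hs]
  set n : ℝ := (Fintype.card ι : ℝ)
  have e : (#z : ℝ) * (c ^ (#z - 1) * tent p M ((#z - 1 : ℕ) : ℝ))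
      = c ^ #z * (#z / c * tent p M (#z - 1)) := by
    rcases Nat.eq_zero_or_pos #z with h0 | h0
    · simp [h0]
    · rw [Nat.cast_sub h0, Nat.cast_one]
      obtain ⟨k, hk⟩ := Nat.exists_eq_succ_of_ne_zero h0.ne'
      rw [hk]
      simp only [Nat.succ_eq_add_one, add_tsub_cancel_right, pow_succ]
      field_simp
  rw [e]
  push_cast
  set k : ℝ := (#z : ℝ)
  have hk0 : 0 ≤ k := Nat.cast_nonneg _
  suffices h : μ * n * (2 - 2 / M) * tent p M k
      ≤ k / c * tent p M (k - 1) + (n - k) * c * tent p M (k + 1) by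
    have := mul_le_mul_of_nonneg_left h (pow_nonneg hc.le #z)
    rw [pow_succ]
    linarith
  have t1 := tent_nonneg p M (k - 1)
  have t2 := tent_nonneg p M (k + 1)
  rcases le_total (M - |k - p|) 0 with h | h
  · rw [tent, max_eq_left h, mul_zero]
    have := sub_nonneg.2 hle
    positivity
  · obtain ⟨ha, hb⟩ := abs_le.1 (sub_nonneg.1 h)
    have hn : 0 ≤ n := hk0.trans hle
    have g1 : μ * n ≤ k / c := by
      rw [le_div_iff₀ hc]
      linarith
    have g2 : μ * n ≤ (n - k) * c := h2.trans (by gcongr; linarith)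
    calc μ * n * (2 - 2 / M) * tent p M k
        = μ * n * ((2 - 2 / M) * tent p M k) := by ring
      _ ≤ μ * n * (tent p M (k - 1) + tent p M (k + 1)) := by
          have := tent_mul_le hM p k
          gcongr
      _ = μ * n * tent p M (k - 1) + μ * n * tent p M (k + 1) := by ring
      _ ≤ _ := by gcongr

/-- An asymptotic form of the first linear programming bound: large families of sets contain two
distinct sets with a small symmetric difference. -/
theorem exists_ne_card_symmDiff_le {ρ η c μ δ θ β : ℝ} (hη : 0 < η) (hc : 0 < c) (hμ : 0 < μ)
    (hδ : 0 < δ) (hθ : 0 < θ) (hθ1 : θ ≤ 1) (h1 : c * μ ≤ ρ - 2 * η) (h2 : μ ≤ (1 - ρ) * c)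
    (h3 : 1 - 2 * δ < 2 * μ) (hβ : θ ^ (-ρ) * (1 + θ) < β) :
    ∃ N : ℕ, ∀ (ι : Type) [Fintype ι] [DecidableEq ι], N ≤ Fintype.card ι →
      ∀ C : Finset (Finset ι), β ^ Fintype.card ι ≤ #C →
        ∃ A ∈ C, ∃ B ∈ C, A ≠ B ∧ (#(A ∆ B) : ℝ) ≤ δ * Fintype.card ι := by
  set b := θ ^ (-ρ) * (1 + θ)
  have hb : 0 < b := by positivity
  have hβ0 : 0 < β := hb.trans hβ
  have l1 : ∀ᶠ n : ℕ in atTop, (n : ℝ) * (b / β) ^ n < 1 / (2 * δ) :=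
    (tendsto_self_mul_const_pow_of_lt_one (by positivity)
      ((div_lt_one hβ0).2 hβ)).eventually_lt_const (by positivity)
  have l2 : ∀ᶠ n : ℕ in atTop, (1 + 2 * μ / η) / (2 * μ - 1 + 2 * δ) ≤ (n : ℝ) :=
    tendsto_natCast_atTop_atTop.eventually_ge_atTop _
  have l3 : ∀ᶠ n : ℕ in atTop, 1 / η ≤ (n : ℝ) :=
    tendsto_natCast_atTop_atTop.eventually_ge_atTop _
  obtain ⟨N, hN⟩ := eventually_atTop.1 (l1.and (l2.and l3))
  refine ⟨N, fun ι _ _ hι C hC => ?_⟩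
  obtain ⟨h4, h5, h6⟩ := hN _ hι
  by_contra! hcon
  have hball := card_filter_card_le_le (ι := ι) hθ hθ1 ρ
  set n := Fintype.card ι with hn
  have hn0 : (0 : ℝ) < n := lt_of_lt_of_le (by positivity) h6
  rw [div_le_iff₀ hη] at h6
  rw [div_le_iff₀ (by linarith)] at h5
  have hρη : 0 < ρ - 2 * η := lt_of_lt_of_le (by positivity) h1
  have hρ1 : 0 < 1 - ρ := pos_of_mul_pos_left (hμ.trans_le h2) hc.le
  have hM : 0 < η * n := by positivity
  have hl : μ * n * (2 - 2 / (η * n)) = 2 * μ * n - 2 * μ / η := by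
    field_simp
  have key := card_mul_le_of_approx_eigenfunction C {z : Finset ι | (#z : ℝ) ≤ ρ * n}
    (f := fun z => c ^ #z * tent ((ρ - η) * n) (η * n) #z)
    (l := μ * n * (2 - 2 / (η * n))) (l' := n - 2 * (δ * n))
    (fun z => mul_nonneg (by positivity) (tent_nonneg _ _ _)) ?_ ?_
    (mul_le_sum_neighbors_tent hc hμ.le hM ?_ ?_) ?_ ?_ ?_
  · rw [← hn, hl] at key
    have k1 : (#C : ℝ) ≤ 2 * (δ * n) * b ^ n := by
      calc (#C : ℝ) = 1 * #C := (one_mul _).symm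
        _ ≤ (2 * μ * n - 2 * μ / η - (n - 2 * (δ * n))) * #C := by gcongr; linarith
        _ ≤ _ := key
        _ = 2 * (δ * n) * #{z : Finset ι | (#z : ℝ) ≤ ρ * n} := by ring
        _ ≤ _ := by gcongr
    rw [div_pow, ← mul_div_assoc, div_lt_div_iff₀ (by positivity) (by positivity)] at h4
    linarith
  · intro z hz
    have hz' : ρ * n < #z := by simpa using hz
    have : η * n - |(#z : ℝ) - (ρ - η) * n| ≤ 0 := by
      have := le_abs_self ((#z : ℝ) - (ρ - η) * n)
      linarith
    simp only [tent, max_eq_left this, mul_zero]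
  · have hp : 0 ≤ (ρ - η) * n := mul_nonneg (by linarith) hn0.le
    have hfl : ⌊(ρ - η) * n⌋₊ ≤ n := by
      refine Nat.floor_le_of_le ?_
      nlinarith
    obtain ⟨z, -, hz⟩ := exists_subset_card_eq (s := (univ : Finset ι)) (by simpa using hfl)
    refine Function.ne_iff.2 ⟨z, ?_⟩
    have g1 := Nat.floor_le hp
    have g2 := Nat.lt_floor_add_one ((ρ - η) * n)
    have : 0 < η * n - |(#z : ℝ) - (ρ - η) * n| := by
      rw [hz, abs_of_nonpos (by linarith)]
      linarith
    have : 0 < tent ((ρ - η) * n) (η * n) #z := lt_max_of_lt_right this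
    simp only [Pi.zero_apply]
    positivity
  · rw [← hn]
    nlinarith
  · rw [← hn]
    nlinarith
  · rw [hl]
    linarith
  · rw [← hn]
    have := mul_pos hδ hn0
    linarith
  · intro x hx y hy hxy
    have := hcon x hx y hy hxy
    rw [← hn]
    linarith

end ClosePairs

section DisjointDifferences

open Finset

variable {α : Type*} [DecidableEq α]

lemma exists_subfamily_disjoint_symmDiff (F : Finset (Finset α)) (S : Finset α) {x : ℝ}
    (h : 2 ^ #S * x ≤ #F) :
    ∃ G ⊆ F, (∀ A ∈ G, ∀ B ∈ G, Disjoint S (A ∆ B)) ∧ x ≤ #G := by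
  obtain ⟨P, -, hP⟩ := exists_le_card_fiber_of_nsmul_le_card_of_maps_to
    (s := F) (t := S.powerset) (f := fun A => A ∩ S) (b := x)
    (fun A _ => mem_powerset.2 inter_subset_right) (powerset_nonempty S)
    (by simpa [card_powerset] using h)
  refine ⟨_, filter_subset _ _, fun A hA B hB => ?_, hP⟩
  have hAB : A ∩ S = B ∩ S := (mem_filter.1 hA).2.trans (mem_filter.1 hB).2.symm
  rw [disjoint_left]
  intro a ha
  have := congrArg (a ∈ ·) hAB
  simp only [mem_inter, ha, and_true, eq_iff_iff] at this
  simp [mem_symmDiff, this]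

/-- A close pair in families of `#G` subsets of `T` gives a close pair in a family `G` all of whose
symmetric differences lie in `T`. -/
lemma exists_ne_card_symmDiff_le_of_subset {G : Finset (Finset α)} {T : Finset α} {d : ℝ}
    (hG : ∀ A ∈ G, ∀ B ∈ G, A ∆ B ⊆ T)
    (h : ∀ C : Finset (Finset T), #C = #G →
      ∃ A ∈ C, ∃ B ∈ C, A ≠ B ∧ (#(A ∆ B) : ℝ) ≤ d) :
    ∃ A ∈ G, ∃ B ∈ G, A ≠ B ∧ (#(A ∆ B) : ℝ) ≤ d := by
  have hmap : ∀ A ∈ G, ∀ B ∈ G,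
      (A.subtype (· ∈ T) ∆ B.subtype (· ∈ T)).map (.subtype _) = A ∆ B := fun A hA B hB => by
    ext a
    have := @hG A hA B hB a
    simp only [mem_symmDiff] at this
    simp only [mem_map, mem_symmDiff, mem_subtype, Function.Embedding.subtype_apply,
      Subtype.exists, exists_and_right, exists_eq_right]
    grind
  have hinj : Set.InjOn (fun A : Finset α => A.subtype (· ∈ T)) G := fun A hA B hB hAB => by
    have h0 := hmap A hA B hB
    rw [show A.subtype (· ∈ T) = B.subtype (· ∈ T) from hAB, symmDiff_self, bot_eq_empty,
      map_empty] at h0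
    exact symmDiff_eq_bot.1 h0.symm
  obtain ⟨A', hA', B', hB', hne, hd⟩ := h (G.image fun A => A.subtype (· ∈ T))
    (card_image_of_injOn hinj)
  obtain ⟨A, hA, rfl⟩ := mem_image.1 hA'
  obtain ⟨B, hB, rfl⟩ := mem_image.1 hB'
  refine ⟨A, hA, B, hB, fun e => hne (by rw [e]), ?_⟩
  rwa [← hmap A hA B hB, card_map]

end DisjointDifferences

lemma rpow_neg_mul_lt_two_rpow {a b ρ e : ℝ} (k p q : ℕ) (ha : 0 < a) (hρ : ρ * k = p)
    (he : e * k = q) (h : a⁻¹ ^ p * b ^ k < 2 ^ q) : a ^ (-ρ) * b < 2 ^ e := by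
  refine lt_of_pow_lt_pow_left₀ k (by positivity) ?_
  rw [mul_pow, ← Real.rpow_mul_natCast ha.le, ← Real.rpow_mul_natCast zero_le_two, he, neg_mul, hρ,
    Real.rpow_neg ha.le, Real.rpow_natCast, Real.rpow_natCast, ← inv_pow]
  exact h

set_option exponentiation.threshold 500 in
/-- There is `N` such that for all `n ≥ N`: every family `F` of at least `2^(0.44 n)`
subsets of `[n]` contains three pairs of distinct sets whose symmetric differences
`A ∆ B`, `C ∆ D`, `E ∆ F'` are pairwise disjoint. -/
theorem three_disjoint_symmDiffs :
    ∃ N : ℕ, ∀ n : ℕ, N ≤ n →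
      ∀ F : Finset (Finset (Fin n)),
        (2 : ℝ) ^ ((0.44 : ℝ) * (n : ℝ)) ≤ (F.card : ℝ) →
        ∃ A ∈ F, ∃ B ∈ F, ∃ C ∈ F, ∃ D ∈ F, ∃ E ∈ F, ∃ F' ∈ F,
          A ≠ B ∧ C ≠ D ∧ E ≠ F' ∧
          Disjoint (A ∆ B) (C ∆ D) ∧ Disjoint (A ∆ B) (E ∆ F') ∧
          Disjoint (C ∆ D) (E ∆ F') := by
  obtain ⟨N₁, hN₁⟩ := exists_ne_card_symmDiff_le (ρ := 1 / 11) (η := 0.00005) (c := 0.316)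
    (μ := 0.2872) (δ := 0.213) (θ := 1 / 10) (β := 2 ^ (0.44 : ℝ)) (by norm_num) (by norm_num)
    (by norm_num) (by norm_num) (by norm_num) (by norm_num) (by norm_num) (by norm_num)
    (by norm_num)
    (rpow_neg_mul_lt_two_rpow 275 25 121 (by norm_num) (by norm_num) (by norm_num) (by norm_num))
  obtain ⟨N₂, hN₂⟩ := exists_ne_card_symmDiff_le (ρ := 1 / 20) (η := 0.00005) (c := 0.229)
    (μ := 0.2175) (δ := 0.283) (θ := 1 / 19) (β := 2 ^ (0.288 : ℝ)) (by norm_num) (by norm_num)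
    (by norm_num) (by norm_num) (by norm_num) (by norm_num) (by norm_num) (by norm_num)
    (by norm_num)
    (rpow_neg_mul_lt_two_rpow 500 25 144 (by norm_num) (by norm_num) (by norm_num) (by norm_num))
  refine ⟨N₁ + 2 * N₂ + 1000, fun n hn F hF => ?_⟩
  have hn' : (N₁ : ℝ) + 2 * N₂ + 1000 ≤ n := by exact_mod_cast hn
  have hN₁0 : (0 : ℝ) ≤ N₁ := Nat.cast_nonneg _
  have hN₂0 : (0 : ℝ) ≤ N₂ := Nat.cast_nonneg _
  obtain ⟨A, hA, B, hB, hAB, hABc⟩ := hN₁ (Fin n) (by simp; omega) F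
    (by rwa [Fintype.card_fin, ← Real.rpow_mul_natCast zero_le_two])
  rw [Fintype.card_fin] at hABc
  have hfl := Nat.floor_le (a := 0.213 * (n : ℝ)) (by positivity)
  have hfl' := Nat.lt_floor_add_one (0.213 * (n : ℝ))
  obtain ⟨S, hABS, -, hS⟩ := Finset.exists_subsuperset_card_eq (Finset.subset_univ (A ∆ B))
    (n := ⌊0.213 * (n : ℝ)⌋₊) (Nat.le_floor hABc)
    (by
      rw [Finset.card_univ, Fintype.card_fin]
      exact Nat.floor_le_of_le (by linarith))
  rw [← hS] at hfl hfl'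
  obtain ⟨G, hGF, hG, hGc⟩ := exists_subfamily_disjoint_symmDiff F S
    (x := 2 ^ (0.44 * (n : ℝ) - S.card)) (by
      rw [← Real.rpow_natCast, ← Real.rpow_add two_pos]
      simpa using hF)
  have hT : (Fintype.card (Sᶜ : Finset (Fin n)) : ℝ) = n - S.card := by
    rw [Fintype.card_coe, Finset.card_compl, Fintype.card_fin, Nat.cast_sub]
    simpa using Finset.card_le_univ S
  obtain ⟨C, hC, D, hD, hCD, hCDc⟩ := exists_ne_card_symmDiff_le_of_subset (G := G) (T := Sᶜ)
    (fun A hA B hB => Finset.subset_compl_iff_disjoint_left.2 (hG A hA B hB))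
    (fun C hC => hN₂ (Sᶜ : Finset (Fin n))
      (by
        have : (N₂ : ℝ) ≤ Fintype.card (Sᶜ : Finset (Fin n)) := by rw [hT]; linarith
        exact_mod_cast this) C
      (by
        rw [hC, ← Real.rpow_mul_natCast zero_le_two, hT]
        refine le_trans ?_ hGc
        exact Real.rpow_le_rpow_of_exponent_le one_le_two (by linarith)))
  rw [hT] at hCDc
  have hU : ((S ∪ C ∆ D).card : ℝ) < 0.44 * n := by
    have : ((S ∪ C ∆ D).card : ℝ) ≤ S.card + (C ∆ D).card := by
      exact_mod_cast Finset.card_union_le _ _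
    linarith
  obtain ⟨H, hHF, hH, hHc⟩ := exists_subfamily_disjoint_symmDiff F (S ∪ C ∆ D)
    (x := 2 ^ (0.44 * (n : ℝ) - (S ∪ C ∆ D).card)) (by
      rw [← Real.rpow_natCast, ← Real.rpow_add two_pos]
      simpa using hF)
  have hH1 : 1 < H.card := by
    have := (Real.one_lt_rpow one_lt_two (sub_pos.2 hU)).trans_le hHc
    exact_mod_cast this
  obtain ⟨E, hE, E', hE', hEE⟩ := Finset.one_lt_card.1 hH1
  have hd := Finset.disjoint_union_left.1 (hH E hE E' hE')
  exact ⟨A, hA, B, hB, C, hGF hC, D, hGF hD, E, hHF hE, E', hHF hE', hAB, hCD, hEE,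
    (hG C hC D hD).mono_left hABS, hd.1.mono_left hABS, hd.2⟩
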